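/- Let G be a group and F = (τ₁,…,τ_m) a tuple of elements of G whose product τ₁·τ₂⋯τ_m = φ is a central element of G. If ψ = τ_{i₁}·τ_{i₂}⋯τ_{i_k} is a product of entries of F (with arbitrary, possibly repeated, indices i₁,…,i_k ∈ {1,…,m}), then the simultaneously conjugated tuple F^ψ = (ψ⁻¹τ₁ψ,…,ψ⁻¹τ_mψ) is Hurwitz equivalent to F. -/

import Mathlib

/-- A single Hurwitz move: replace consecutive entries `(x, y)` by `(x*y*x⁻¹, x)`. -/
inductive HurwitzStep {G : Type*} [Group G] : List G → List G → Prop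
  | move (l₁ l₂ : List G) (x y : G) :
      HurwitzStep (l₁ ++ x :: y :: l₂) (l₁ ++ (x * y * x⁻¹) :: x :: l₂)

/-- Hurwitz equivalence: a finite sequence of Hurwitz moves and inverse Hurwitz moves. -/
def HurwitzEquiv {G : Type*} [Group G] : List G → List G → Prop :=
  Relation.ReflTransGen (fun a b => HurwitzStep a b ∨ HurwitzStep b a)

theorem coe_conj_inv {G : Type*} [Group G] (t : G) :
    ⇑(MulAut.conj t⁻¹) = fun x => t⁻¹ * x * t := by
  ext x
  simp only [MulAut.conj_apply, inv_inv]

namespace HurwitzEquiv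

variable {G H : Type*} [Group G] [Group H]

theorem refl (a : List G) : HurwitzEquiv a a :=
  Relation.ReflTransGen.refl

theorem trans {a b c : List G} (hab : HurwitzEquiv a b) (hbc : HurwitzEquiv b c) :
    HurwitzEquiv a c :=
  Relation.ReflTransGen.trans hab hbc

theorem symm {a b : List G} (h : HurwitzEquiv a b) : HurwitzEquiv b a := by
  induction h with
  | refl => exact refl a
  | tail _ hstep ih => exact Relation.ReflTransGen.head hstep.symm ih

theorem of_step {a b : List G} (h : HurwitzStep a b) : HurwitzEquiv a b :=
  Relation.ReflTransGen.single (Or.inl h)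

theorem lift {f : List G → List H} (hf : ∀ a b, HurwitzStep a b → HurwitzStep (f a) (f b))
    {a b : List G} (h : HurwitzEquiv a b) : HurwitzEquiv (f a) (f b) :=
  Relation.ReflTransGen.lift f (fun a b => Or.imp (hf a b) (hf b a)) a b h

theorem map (f : G →* H) {a b : List G} (h : HurwitzEquiv a b) :
    HurwitzEquiv (a.map f) (b.map f) := by
  refine h.lift ?_
  rintro _ _ ⟨l₁, l₂, x, y⟩
  simpa using HurwitzStep.move (l₁.map f) (l₂.map f) (f x) (f y)

theorem append_left (l : List G) {a b : List G} (h : HurwitzEquiv a b) :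
    HurwitzEquiv (l ++ a) (l ++ b) := by
  refine h.lift (f := (l ++ ·)) ?_
  rintro _ _ ⟨l₁, l₂, x, y⟩
  simpa using HurwitzStep.move (l ++ l₁) l₂ x y

theorem append_right (l : List G) {a b : List G} (h : HurwitzEquiv a b) :
    HurwitzEquiv (a ++ l) (b ++ l) := by
  refine h.lift (f := (· ++ l)) ?_
  rintro _ _ ⟨l₁, l₂, x, y⟩
  simpa using HurwitzStep.move l₁ (l₂ ++ l) x y

theorem swap (x y : G) (l : List G) :
    HurwitzEquiv (x :: y :: l) (y :: (y⁻¹ * x * y) :: l) := by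
  refine (of_step ?_).symm
  simpa [mul_assoc] using HurwitzStep.move [] l y (y⁻¹ * x * y)

/-- The last entry can be moved to the front, conjugating the entries it passes. -/
theorem append_singleton (a : List G) (t : G) :
    HurwitzEquiv (a ++ [t]) (t :: a.map (fun x => t⁻¹ * x * t)) := by
  induction a with
  | nil => exact refl _
  | cons x a ih => exact (ih.append_left [x]).trans (swap x t _)

/-- The first entry can be moved to the end, being conjugated by the entries it passes. -/
theorem cons_conj (a : List G) (t : G) :
    HurwitzEquiv (t :: a) (a ++ [a.prod⁻¹ * t * a.prod]) := by
  induction a generalizing t with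
  | nil => simpa using refl [t]
  | cons x a ih =>
    have h := (swap t x a).trans ((ih (x⁻¹ * t * x)).append_left [x])
    simpa [mul_assoc] using h

/-- A factorization of a central element is equivalent to its conjugate by any of its entries. -/
theorem conj_of_mem {F : List G} (hF : ∀ x : G, F.prod * x = x * F.prod) {t : G} (ht : t ∈ F) :
    HurwitzEquiv F (F.map (fun x => t⁻¹ * x * t)) := by
  obtain ⟨a, b, rfl⟩ := List.append_of_mem ht
  set a' := a.map (fun x => t⁻¹ * x * t) with ha'
  have hprod : t * a'.prod = a.prod * t := by
    have h := List.prod_hom a (MulAut.conj t⁻¹)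
    rw [coe_conj_inv] at h
    rw [ha', h]
    group
  have hconj : (a' ++ b).prod⁻¹ * t * (a' ++ b).prod = t := by
    have hp : (a ++ t :: b).prod = t * (a' ++ b).prod := by
      simp only [List.prod_append, List.prod_cons, ← mul_assoc, hprod]
    have hc := hF t
    rw [hp, mul_assoc] at hc
    rw [mul_assoc, ← mul_left_cancel hc, inv_mul_cancel_left]
  have h₁ : HurwitzEquiv (a ++ t :: b) (t :: (a' ++ b)) := by
    simpa using (append_singleton a t).append_right b
  have h₂ : HurwitzEquiv (t :: (a' ++ b)) (a' ++ (b ++ [t])) := by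
    simpa only [hconj, List.append_assoc] using cons_conj (a' ++ b) t
  simpa [ha'] using (h₁.trans h₂).trans ((append_singleton b t).append_left a')

end HurwitzEquiv

/-- If `F` is a factorization of a central element and `ψ` is a product of (possibly
repeated) entries of `F`, then the simultaneous conjugate `F^ψ` is Hurwitz
equivalent to `F`. -/
theorem conj_by_product_of_factors {G : Type*} [Group G] (F : List G) (φ : G)
    (hprod : F.prod = φ) (hcentral : ∀ x : G, φ * x = x * φ)
    (ψ : G) (l : List G) (hl : ∀ x ∈ l, x ∈ F) (hψ : ψ = l.prod) :
    HurwitzEquiv (F.map (fun x => ψ⁻¹ * x * ψ)) F := by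
  subst hprod hψ
  refine HurwitzEquiv.symm ?_
  induction l with
  | nil => simpa using HurwitzEquiv.refl F
  | cons t l ih =>
    have h := (HurwitzEquiv.conj_of_mem hcentral (hl t List.mem_cons_self)).map
      (MulAut.conj l.prod⁻¹).toMonoidHom
    refine (ih fun x hx => hl x (List.mem_cons_of_mem t hx)).trans ?_
    rw [MulEquiv.toMonoidHom_eq_coe, MonoidHom.coe_coe, coe_conj_inv] at h
    simpa [Function.comp_def, mul_assoc] using h
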